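/- In the isthmus setting with generic parameters, every critical point (x,λ₀) ∈ (ℂ∖{0})^d × ℂ of D has x a corner point, i.e. x_j² = 1 for every j = 1,…,d. -/

import Mathlib

/-- The principal minor: determinant of the submatrix of `N` on rows and columns of index
`< s` (equal to `1` when `s = 0`). -/
noncomputable def Pminor {n : ℕ} (N : Matrix (Fin n) (Fin n) ℂ) (s : ℕ) : ℂ :=
  (N.submatrix (fun i : Fin (min s n) => Fin.castLE (min_le_right s n) i)
    (fun i : Fin (min s n) => Fin.castLE (min_le_right s n) i)).det

/-- The co-principal minor: determinant of the submatrix of `N` on rows and columns of index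
`> s` (equal to `1` when `s = n − 1`). -/
noncomputable def Qminor {n : ℕ} (N : Matrix (Fin n) (Fin n) ℂ) (s : ℕ) : ℂ :=
  (N.submatrix (fun i : Fin (n - 1 - s) => (⟨s + 1 + i.1, by have := i.2; omega⟩ : Fin n))
    (fun i : Fin (n - 1 - s) => (⟨s + 1 + i.1, by have := i.2; omega⟩ : Fin n))).det

/-- The Floquet matrix of a periodic isthmus-connected graph: the matrix `M` with
`E_j·(z_j + z_j⁻¹)` added to the diagonal entry `(f j, f j)` for each `j`. -/
noncomputable def isthH (a m b d : ℕ) (M : Matrix (Fin (a + m + b)) (Fin (a + m + b)) ℝ)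
    (f : Fin d → Fin (a + m + b)) (E : Fin d → ℝ) (z : Fin d → ℂ) :
    Matrix (Fin (a + m + b)) (Fin (a + m + b)) ℂ :=
  Matrix.of fun i i' => (M i i' : ℂ) +
    if i = i' then ∑ j, (if f j = i then (E j : ℂ) * (z j + (z j)⁻¹) else 0) else 0

/-- The dispersion polynomial `D(z,λ) = det(H(z) − λ·I)`. -/
noncomputable def isthD (a m b d : ℕ) (M : Matrix (Fin (a + m + b)) (Fin (a + m + b)) ℝ)
    (f : Fin d → Fin (a + m + b)) (E : Fin d → ℝ) (z : Fin d → ℂ) (lam : ℂ) : ℂ :=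
  (isthH a m b d M f E z - lam • 1).det

/-- `P_s(z,λ)`: the principal minor of `H(z) − λ·I` on indices `< s`. -/
noncomputable def isthP (a m b d : ℕ) (M : Matrix (Fin (a + m + b)) (Fin (a + m + b)) ℝ)
    (f : Fin d → Fin (a + m + b)) (E : Fin d → ℝ) (s : ℕ) (z : Fin d → ℂ) (lam : ℂ) : ℂ :=
  Pminor (isthH a m b d M f E z - lam • 1) s

/-- `Q_s(z,λ)`: the co-principal minor of `H(z) − λ·I` on indices `> s`. -/
noncomputable def isthQ (a m b d : ℕ) (M : Matrix (Fin (a + m + b)) (Fin (a + m + b)) ℝ)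
    (f : Fin d → Fin (a + m + b)) (E : Fin d → ℝ) (s : ℕ) (z : Fin d → ℂ) (lam : ℂ) : ℂ :=
  Qminor (isthH a m b d M f E z - lam • 1) s

/-- The partial derivative `∂D/∂z_j`. -/
noncomputable def isthPD (a m b d : ℕ) (M : Matrix (Fin (a + m + b)) (Fin (a + m + b)) ℝ)
    (f : Fin d → Fin (a + m + b)) (E : Fin d → ℝ) (j : Fin d) (z : Fin d → ℂ) (lam : ℂ) : ℂ :=
  deriv (fun t => isthD a m b d M f E (Function.update z j t) lam) (z j)

/-- The second partial derivative `∂²D/∂z_j∂z_i`. -/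
noncomputable def isthPD2 (a m b d : ℕ) (M : Matrix (Fin (a + m + b)) (Fin (a + m + b)) ℝ)
    (f : Fin d → Fin (a + m + b)) (E : Fin d → ℝ) (i j : Fin d) (z : Fin d → ℂ) (lam : ℂ) : ℂ :=
  deriv (fun s => isthPD a m b d M f E i (Function.update z j s) lam) (z j)

namespace Matrix

variable {ι R : Type*} [Fintype ι] [DecidableEq ι] [CommRing R]

/-- The matrix whose rows in `S` are those of `N` and whose other rows are those of the identity. -/
def maskRows (N : Matrix ι ι R) (S : Finset ι) : Matrix ι ι R :=
  of fun i j => if i ∈ S then N i j else (1 : Matrix ι ι R) i j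

/-- The principal minor of `N` on the index set `S`, as a determinant of full size. -/
def principalMinor (N : Matrix ι ι R) (S : Finset ι) : R := (N.maskRows S).det

theorem det_submatrix_eq_principalMinor {κ : Type*} [Fintype κ] [DecidableEq κ]
    (N : Matrix ι ι R) (S : Finset ι) (g : κ → ι) (hg : Function.Injective g)
    (hS : ∀ i, i ∈ S ↔ ∃ k, g k = i) :
    (N.submatrix g g).det = N.principalMinor S := by
  rw [principalMinor, twoBlockTriangular_det _ (· ∈ S)]
  · have h2 : toSquareBlockProp (N.maskRows S) (fun i => ¬ i ∈ S) = 1 := by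
      ext i j
      simp [toSquareBlockProp, maskRows, i.2, one_apply, Subtype.ext_iff]
    rw [h2, det_one, mul_one]
    let e : κ ≃ {i // i ∈ S} := Equiv.ofBijective (fun k => ⟨g k, (hS _).2 ⟨k, rfl⟩⟩) <| by
      refine ⟨fun k l h => hg (congrArg Subtype.val h), fun ⟨i, hi⟩ => ?_⟩
      obtain ⟨k, hk⟩ := (hS i).1 hi
      exact ⟨k, Subtype.ext hk⟩
    have h1 : N.submatrix g g = (toSquareBlockProp (N.maskRows S) (· ∈ S)).submatrix e e := by
      ext k l
      have he : ∀ k, (e k : ι) = g k := fun _ => rfl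
      simp [he, toSquareBlockProp, maskRows, (hS (g k)).2 ⟨k, rfl⟩]
    rw [h1]
    convert det_submatrix_equiv_self e _
  · intro i hi j hj
    have : i ≠ j := fun h => hi (h ▸ hj)
    simp [maskRows, hi, this]

theorem principalMinor_univ (N : Matrix ι ι R) : N.principalMinor Finset.univ = N.det := by
  simpa using (det_submatrix_eq_principalMinor N Finset.univ id Function.injective_id (by simp)).symm

theorem principalMinor_empty (N : Matrix ι ι R) : N.principalMinor ∅ = 1 := by
  have : N.maskRows ∅ = 1 := by ext i j; simp [maskRows]
  rw [principalMinor, this, det_one]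

theorem principalMinor_congr {N N' : Matrix ι ι R} {S : Finset ι}
    (h : ∀ i ∈ S, ∀ j ∈ S, N i j = N' i j) : N.principalMinor S = N'.principalMinor S := by
  rw [← det_submatrix_eq_principalMinor N S (Subtype.val : S → ι) Subtype.val_injective (by simp),
    ← det_submatrix_eq_principalMinor N' S (Subtype.val : S → ι) Subtype.val_injective (by simp)]
  congr 1
  ext i j
  exact h i i.2 j j.2

theorem principalMinor_union (N : Matrix ι ι R) {S T : Finset ι}
    (h : ∀ i ∈ S, ∀ j ∈ T, N i j = 0) :
    N.principalMinor (S ∪ T) = N.principalMinor S * N.principalMinor T := by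
  rw [principalMinor, principalMinor, principalMinor, ← det_mul]
  congr 1
  ext i j
  rw [mul_apply]
  by_cases hi : i ∈ S
  · rw [Finset.sum_eq_single j]
    · by_cases hj : j ∈ T <;> simp [maskRows, hi, hj, h i hi]
    · intro k _ hk
      by_cases hkT : k ∈ T <;> simp [maskRows, hi, hk, hkT, h i hi]
    · simp
  · rw [Finset.sum_eq_single i]
    · simp [maskRows, hi]
    · intro k _ hk
      simp [maskRows, hi, hk.symm]
    · simp

theorem det_updateRow_maskRows_single (N : Matrix ι ι R) {S : Finset ι} {u : ι} (c : R) :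
    ((N.maskRows S).updateRow u (c • Pi.single u 1)).det = c * N.principalMinor (S.erase u) := by
  rw [det_updateRow_smul, principalMinor]
  congr 2
  ext i j
  by_cases hi : i = u
  · subst hi
    simp [maskRows, one_apply, Pi.single_apply, eq_comm]
  · simp [maskRows, hi]

/-- Adding `w` to a diagonal entry changes the determinant by `w` times the complementary minor. -/
theorem det_add_single_diag (N : Matrix ι ι R) (u : ι) (w : R) :
    (N + single u u w).det = N.det + w * N.principalMinor (Finset.univ.erase u) := by
  have h : N + single u u w = N.updateRow u (N u + w • Pi.single u 1) := by
    ext i j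
    by_cases hi : i = u
    · subst hi
      by_cases hj : i = j
      · subst hj; simp
      · simp [hj, Ne.symm hj]
    · simp [hi, Ne.symm hi]
  have h1 : N = N.maskRows Finset.univ := by ext i j; simp [maskRows]
  rw [h, det_updateRow_add, updateRow_eq_self, ← det_updateRow_maskRows_single, ← h1]

/-- If two disjoint index sets are coupled only through the entries `(u, v)` and `(v, u)`, the
principal minor on their union is given by a three-term formula. -/
theorem principalMinor_union_of_bridge (N : Matrix ι ι R) {S T : Finset ι} (hd : Disjoint S T)
    {u v : ι} (hu : u ∈ S) (hv : v ∈ T)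
    (h₁ : ∀ i ∈ S, ∀ j ∈ T, ¬(i = u ∧ j = v) → N i j = 0)
    (h₂ : ∀ i ∈ T, ∀ j ∈ S, ¬(i = v ∧ j = u) → N i j = 0) :
    N.principalMinor (S ∪ T) = N.principalMinor S * N.principalMinor T
      - N u v * N v u * (N.principalMinor (S.erase u) * N.principalMinor (T.erase v)) := by
  have hST : ∀ i ∈ S, i ∉ T := fun i hi hi' => Finset.disjoint_left.1 hd hi hi'
  have huv : u ≠ v := fun h => hST u hu (h ▸ hv)
  set K := N.maskRows (S ∪ T) with hK
  have hrow : K = K.updateRow u (Function.update (N u) v 0 + N u v • Pi.single v 1) := by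
    ext i j
    by_cases hi : i = u
    · subst hi
      by_cases hj : j = v
      · subst hj; simp [hK, maskRows, hu]
      · simp [hK, maskRows, hu, hj]
    · simp [hi]
  -- dropping the entry `(u, v)` decouples the two sets
  have hfirst : (K.updateRow u (Function.update (N u) v 0)).det
      = N.principalMinor S * N.principalMinor T := by
    set N' := N.updateRow u (Function.update (N u) v 0) with hN'
    have e1 : K.updateRow u (Function.update (N u) v 0) = N'.maskRows (S ∪ T) := by
      ext i j
      by_cases hi : i = u
      · subst hi; simp [hN', maskRows, hu]
      · simp [hN', hK, maskRows, hi]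
    rw [e1, ← principalMinor, principalMinor_union]
    · congr 1
      · refine principalMinor_congr fun i hi j hj => ?_
        have : j ≠ v := fun h => hST j hj (h ▸ hv)
        by_cases hi : i = u
        · subst hi; simp [hN', this]
        · simp [hN', hi]
      · refine principalMinor_congr fun i hi j hj => ?_
        have : i ≠ u := fun h => hST u hu (h ▸ hi)
        simp [hN', this]
    · intro i hi j hj
      by_cases hiu : i = u
      · subst hiu
        by_cases hjv : j = v
        · subst hjv; simp [hN']
        · simpa [hN', hjv] using h₁ i hi j hj (by tauto)
      · simpa [hN', hiu] using h₁ i hi j hj (by tauto)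
  -- swapping the rows `u` and `v` decouples the remaining term
  have hsecond : (K.updateRow u (Pi.single v 1)).det
      = -(N v u * (N.principalMinor (S.erase u) * N.principalMinor (T.erase v))) := by
    set L := N.updateRow u (N v) with hL
    have e1 : (K.updateRow u (Pi.single v 1)).submatrix (Equiv.swap u v) id
        = L.maskRows (S ∪ T.erase v) := by
      ext i j
      by_cases hi : i = u
      · subst hi; simp [hL, hK, maskRows, hu, hv, huv.symm]
      · by_cases hi' : i = v
        · subst hi'
          have : i ∉ S := fun h => hST i h hv
          simp [maskRows, this, one_apply, Pi.single_apply, eq_comm]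
        · simp [hL, hK, maskRows, hi, hi', Equiv.swap_apply_of_ne_of_ne hi hi']
    have e2 := det_permute (Equiv.swap u v) (K.updateRow u (Pi.single v 1))
    rw [e1, Equiv.Perm.sign_swap huv, ← principalMinor, Finset.union_comm,
      principalMinor_union] at e2
    · have e3 : L.principalMinor (T.erase v) = N.principalMinor (T.erase v) := by
        refine principalMinor_congr fun i hi j hj => ?_
        have : i ≠ u := fun h => hST u hu (h ▸ Finset.mem_of_mem_erase hi)
        simp [hL, this]
      have e4 : L.principalMinor S = N v u * N.principalMinor (S.erase u) := by
        rw [← det_updateRow_maskRows_single]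
        have : (N.maskRows S).updateRow u (N v u • Pi.single u 1)
            = (N.updateRow u (N v u • Pi.single u 1)).maskRows S := by
          ext i j
          by_cases hi : i = u
          · subst hi; simp [maskRows, hu]
          · simp [maskRows, hi]
        rw [this, ← principalMinor]
        refine principalMinor_congr fun i hi j hj => ?_
        by_cases hi : i = u
        · subst hi
          by_cases hj' : j = i
          · subst hj'; simp [hL]
          · simpa [hL, hj'] using h₂ v hv j hj (by tauto)
        · simp [hL, hi]
      rw [e3, e4] at e2
      simp only [Units.val_neg, Units.val_one, Int.cast_neg, Int.cast_one] at e2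
      linear_combination e2
    · intro i hi j hj
      have hi' := Finset.mem_of_mem_erase hi
      have : i ≠ u := fun h => hST u hu (h ▸ hi')
      simpa [hL, this] using h₂ i hi' j hj (fun h => Finset.ne_of_mem_erase hi h.1)
  rw [principalMinor, ← hK, hrow, det_updateRow_add, det_updateRow_smul, hfirst, hsecond]
  ring

end Matrix

theorem Pminor_eq_principalMinor {n : ℕ} (N : Matrix (Fin n) (Fin n) ℂ) (s : ℕ) :
    Pminor N s = N.principalMinor (Finset.univ.filter fun i => (i : ℕ) < s) := by
  refine Matrix.det_submatrix_eq_principalMinor N _ _ (Fin.castLE_injective _) fun i => ?_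
  simp only [Finset.mem_filter, Finset.mem_univ, true_and]
  exact ⟨fun h => ⟨⟨i, by have := i.2; omega⟩, rfl⟩, by rintro ⟨k, rfl⟩; have := k.2; simp; omega⟩

theorem Qminor_eq_principalMinor {n : ℕ} (N : Matrix (Fin n) (Fin n) ℂ) (s : ℕ) :
    Qminor N s = N.principalMinor (Finset.univ.filter fun i => s + 1 ≤ (i : ℕ)) := by
  refine Matrix.det_submatrix_eq_principalMinor N _ _ (fun k l h => ?_) fun i => ?_
  · simp only [Fin.mk.injEq] at h
    exact Fin.ext (by omega)
  · simp only [Finset.mem_filter, Finset.mem_univ, true_and]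
    constructor
    · intro h
      exact ⟨⟨i - (s + 1), by have := i.2; omega⟩, Fin.ext (by simp; omega)⟩
    · rintro ⟨k, rfl⟩
      simp

namespace Matrix

/-- The principal minor on the indices `k` with `s ≤ k < t`. -/
noncomputable def intervalMinor {n : ℕ} (N : Matrix (Fin n) (Fin n) ℂ) (s t : ℕ) : ℂ :=
  N.principalMinor (Finset.univ.filter fun i => s ≤ (i : ℕ) ∧ (i : ℕ) < t)

theorem Pminor_eq_intervalMinor {n : ℕ} (N : Matrix (Fin n) (Fin n) ℂ) (s : ℕ) :
    Pminor N s = N.intervalMinor 0 s := by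
  simp [Pminor_eq_principalMinor, intervalMinor]

theorem Qminor_eq_intervalMinor {n : ℕ} (N : Matrix (Fin n) (Fin n) ℂ) (s : ℕ) :
    Qminor N s = N.intervalMinor (s + 1) n := by
  simp [Qminor_eq_principalMinor, intervalMinor]

theorem det_eq_intervalMinor {n : ℕ} (N : Matrix (Fin n) (Fin n) ℂ) :
    N.det = N.intervalMinor 0 n := by
  simp [intervalMinor, principalMinor_univ]

theorem intervalMinor_self {n : ℕ} (N : Matrix (Fin n) (Fin n) ℂ) {s t : ℕ} (h : t ≤ s) :
    N.intervalMinor s t = 1 := by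
  rw [intervalMinor, Finset.filter_false_of_mem, principalMinor_empty]
  intro i _
  omega

theorem intervalMinor_congr {n : ℕ} {N N' : Matrix (Fin n) (Fin n) ℂ} {s t : ℕ}
    (h : ∀ i j : Fin n, s ≤ (i : ℕ) → (i : ℕ) < t → N i j = N' i j) :
    N.intervalMinor s t = N'.intervalMinor s t := by
  refine principalMinor_congr fun i hi j _ => ?_
  simp only [Finset.mem_filter, Finset.mem_univ, true_and] at hi
  exact h i j hi.1 hi.2

/-- The three-term relation obtained by cutting the interval `[s, t)` at the bridge `{k, k + 1}`. -/
theorem intervalMinor_bridge {n : ℕ} (N : Matrix (Fin n) (Fin n) ℂ) {s t k : ℕ} (hsk : s ≤ k)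
    (hkt : k + 1 < t) (htn : t ≤ n)
    (h : ∀ i j : Fin n, (i : ℕ) ≤ k → k + 1 ≤ (j : ℕ) → (j : ℕ) < t →
      ¬((i : ℕ) = k ∧ (j : ℕ) = k + 1) → N i j = 0 ∧ N j i = 0) :
    N.intervalMinor s t = N.intervalMinor s (k + 1) * N.intervalMinor (k + 1) t
      - N ⟨k, by omega⟩ ⟨k + 1, by omega⟩ * N ⟨k + 1, by omega⟩ ⟨k, by omega⟩ *
        (N.intervalMinor s k * N.intervalMinor (k + 2) t) := by
  have key := principalMinor_union_of_bridge N
    (S := Finset.univ.filter fun i : Fin n => s ≤ (i : ℕ) ∧ (i : ℕ) < k + 1)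
    (T := Finset.univ.filter fun i : Fin n => k + 1 ≤ (i : ℕ) ∧ (i : ℕ) < t)
    (u := ⟨k, by omega⟩) (v := ⟨k + 1, by omega⟩)
    (Finset.disjoint_left.2 fun i => by simp; omega) (by simpa using hsk) (by simpa using hkt)
    (fun i hi j hj hij => by
      simp only [Finset.mem_filter, Finset.mem_univ, true_and, Fin.ext_iff] at hi hj hij
      exact (h i j (by omega) hj.1 hj.2 hij).1)
    (fun i hi j hj hij => by
      simp only [Finset.mem_filter, Finset.mem_univ, true_and, Fin.ext_iff] at hi hj hij
      exact (h j i (by omega) hi.1 hi.2 (by tauto)).2)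
  have e₁ : (Finset.univ.filter fun i : Fin n => s ≤ (i : ℕ) ∧ (i : ℕ) < k + 1) ∪
      (Finset.univ.filter fun i : Fin n => k + 1 ≤ (i : ℕ) ∧ (i : ℕ) < t)
      = Finset.univ.filter fun i : Fin n => s ≤ (i : ℕ) ∧ (i : ℕ) < t := by
    ext i; simp; omega
  have e₂ : (Finset.univ.filter fun i : Fin n => s ≤ (i : ℕ) ∧ (i : ℕ) < k + 1).erase
      ⟨k, by omega⟩ = Finset.univ.filter fun i : Fin n => s ≤ (i : ℕ) ∧ (i : ℕ) < k := by
    ext i; simp [Fin.ext_iff]; omega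
  have e₃ : (Finset.univ.filter fun i : Fin n => k + 1 ≤ (i : ℕ) ∧ (i : ℕ) < t).erase
      ⟨k + 1, by omega⟩ = Finset.univ.filter fun i : Fin n => k + 2 ≤ (i : ℕ) ∧ (i : ℕ) < t := by
    ext i; simp [Fin.ext_iff]; omega
  rwa [e₁, e₂, e₃] at key

/-- The minor complementary to `k` factors when `k` separates the indices below and above it. -/
theorem principalMinor_erase_of_separates {n : ℕ} (N : Matrix (Fin n) (Fin n) ℂ) (k : Fin n)
    (h : ∀ i j : Fin n, i < k → k < j → N i j = 0) :
    N.principalMinor (Finset.univ.erase k) = N.intervalMinor 0 k * N.intervalMinor (k + 1) n := by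
  have e : Finset.univ.erase k
      = (Finset.univ.filter fun i : Fin n => 0 ≤ (i : ℕ) ∧ (i : ℕ) < k) ∪
        (Finset.univ.filter fun i : Fin n => (k : ℕ) + 1 ≤ (i : ℕ) ∧ (i : ℕ) < n) := by
    ext i; simp [Fin.ext_iff]
  rw [e, principalMinor_union]
  · rfl
  · intro i hi j hj
    simp only [Finset.mem_filter, Finset.mem_univ, true_and] at hi hj
    exact h i j hi.2 (Fin.lt_def.2 (by omega))

/-- In a matrix whose entries at `{k, k + 1}` are bridges for `a - 1 ≤ k ≤ a + m - 1`, consecutive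
minors do not vanish together, so at a singular matrix the two minors cut off by an isthmus index
vanish together. -/
theorem intervalMinor_eq_zero_iff_of_isthmus {a m n : ℕ} (hamn : a + m ≤ n)
    (N : Matrix (Fin n) (Fin n) ℂ)
    (hN : ∀ k, a ≤ k + 1 → k + 1 ≤ a + m → ∀ i j : Fin n, (i : ℕ) ≤ k → k + 1 ≤ (j : ℕ) →
      ¬((i : ℕ) = k ∧ (j : ℕ) = k + 1) → N i j = 0 ∧ N j i = 0)
    (hne : ∀ k, a ≤ k + 1 → k + 1 ≤ a + m → ∀ h : k + 1 < n,
      N ⟨k, by omega⟩ ⟨k + 1, h⟩ * N ⟨k + 1, h⟩ ⟨k, by omega⟩ ≠ 0)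
    (ha : 0 < a → ¬(N.intervalMinor 0 (a - 1) = 0 ∧ N.intervalMinor 0 a = 0))
    (hb : a + m < n → ¬(N.intervalMinor (a + m) n = 0 ∧ N.intervalMinor (a + m + 1) n = 0))
    (hdet : N.det = 0) {t : ℕ} (hat : a ≤ t) (htm : t < a + m) :
    N.intervalMinor 0 t = 0 ↔ N.intervalMinor (t + 1) n = 0 := by
  have hP : ∀ s, a ≤ s + 1 → s + 1 < a + m →
      ¬(N.intervalMinor 0 s = 0 ∧ N.intervalMinor 0 (s + 1) = 0) := by
    intro s
    induction s with
    | zero => intro _ _ h; simp [intervalMinor_self] at h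
    | succ s ih =>
      rintro h₁ h₂ ⟨h₃, h₄⟩
      obtain h₅ | h₅ : a = s + 1 + 1 ∨ a ≤ s + 1 := by omega
      · exact ha (by omega) (by subst h₅; exact ⟨h₃, h₄⟩)
      · refine ih h₅ (by omega) ⟨?_, h₃⟩
        rw [intervalMinor_bridge N (k := s) (Nat.zero_le _) (by omega) (by omega)
          fun i j hi hj _ => hN s (by omega) (by omega) i j hi hj, h₃,
          intervalMinor_self N le_rfl] at h₄
        have := hne s (by omega) (by omega) (by omega)
        simpa [this] using h₄
  have hQ : ∀ c s, s + c = a + m → a < s → s < n →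
      ¬(N.intervalMinor s n = 0 ∧ N.intervalMinor (s + 1) n = 0) := by
    intro c
    induction c with
    | zero => intro s hs _ hsn; obtain rfl : s = a + m := by omega
              exact hb hsn
    | succ c ih =>
      rintro s hs has hsn ⟨h₃, h₄⟩
      obtain h₅ | h₅ : n = s + 1 ∨ s + 1 < n := by omega
      · rw [intervalMinor_self N h₅.le] at h₄
        exact one_ne_zero h₄
      · refine ih (s + 1) (by omega) (by omega) h₅ ⟨h₄, ?_⟩
        rw [intervalMinor_bridge N (k := s) le_rfl h₅ le_rfl
          fun i j hi hj _ => hN s (by omega) (by omega) i j hi hj, h₄,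
          intervalMinor_self N le_rfl] at h₃
        have := hne s (by omega) (by omega) h₅
        simpa [this] using h₃
  rw [det_eq_intervalMinor] at hdet
  constructor
  · intro h
    cases t with
    | zero => simp [intervalMinor_self] at h
    | succ s =>
      rw [intervalMinor_bridge N (k := s) (Nat.zero_le _) (by omega) le_rfl
        fun i j hi hj _ => hN s (by omega) (by omega) i j hi hj, h] at hdet
      have h₁ := hne s (by omega) (by omega) (by omega)
      have h₂ : N.intervalMinor 0 s ≠ 0 := fun h₂ => hP s hat htm ⟨h₂, h⟩
      simpa [h₁, h₂] using hdet
  · intro h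
    obtain h₅ | h₅ : n = t + 1 ∨ t + 1 < n := by omega
    · rw [intervalMinor_self N h₅.le] at h
      exact absurd h one_ne_zero
    · rw [intervalMinor_bridge N (k := t) (Nat.zero_le _) h₅ le_rfl
        fun i j hi hj _ => hN t (by omega) (by omega) i j hi hj, h] at hdet
      have h₁ := hne t (by omega) (by omega) h₅
      have h₂ : N.intervalMinor (t + 2) n ≠ 0 := fun h₂ =>
        hQ (a + m - (t + 1)) (t + 1) (by omega) (by omega) h₅ ⟨h, h₂⟩
      simpa [h₁, h₂] using hdet

end Matrix

theorem isthH_sub_smul_apply_of_ne {a m b d : ℕ}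
    {M : Matrix (Fin (a + m + b)) (Fin (a + m + b)) ℝ} {f : Fin d → Fin (a + m + b)}
    {E : Fin d → ℝ} {z : Fin d → ℂ} {lam : ℂ} {i j : Fin (a + m + b)} (h : i ≠ j) :
    (isthH a m b d M f E z - lam • 1) i j = (M i j : ℂ) := by
  simp [isthH, h]

theorem isthH_sub_smul_congr {a m b d : ℕ}
    {M : Matrix (Fin (a + m + b)) (Fin (a + m + b)) ℝ} {f : Fin d → Fin (a + m + b)}
    {E : Fin d → ℝ} {z z' : Fin d → ℂ} {lam : ℂ} {i j : Fin (a + m + b)}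
    (h : ∀ l, f l = i → z l = z' l) :
    (isthH a m b d M f E z - lam • 1) i j = (isthH a m b d M f E z' - lam • 1) i j := by
  have : ∑ l, (if f l = i then (E l : ℂ) * (z l + (z l)⁻¹) else 0)
      = ∑ l, (if f l = i then (E l : ℂ) * (z' l + (z' l)⁻¹) else 0) :=
    Finset.sum_congr rfl fun l _ => by
      split_ifs with hl
      · rw [h l hl]
      · rfl
  simp [isthH, this]

theorem isthD_update (a m b d : ℕ) (M : Matrix (Fin (a + m + b)) (Fin (a + m + b)) ℝ)
    (f : Fin d → Fin (a + m + b)) (E : Fin d → ℝ) (j : Fin d) (z : Fin d → ℂ) (lam t : ℂ) :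
    isthD a m b d M f E (Function.update z j t) lam = isthD a m b d M f E z lam
      + E j * ((t + t⁻¹) - (z j + (z j)⁻¹)) *
        (isthH a m b d M f E z - lam • 1).principalMinor (Finset.univ.erase (f j)) := by
  rw [isthD, isthD, ← Matrix.det_add_single_diag]
  congr 1
  ext i i'
  by_cases hi : i = i'
  · subst hi
    have : ∑ l, (if f l = i then
          (E l : ℂ) * (Function.update z j t l + (Function.update z j t l)⁻¹) else 0)
        = ∑ l, (if f l = i then (E l : ℂ) * (z l + (z l)⁻¹) else 0)
          + if f j = i then (E j : ℂ) * ((t + t⁻¹) - (z j + (z j)⁻¹)) else 0 := by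
      rw [← sub_eq_iff_eq_add', ← Finset.sum_sub_distrib, Finset.sum_eq_single j]
      · split_ifs <;> simp; ring
      · intro l _ hl
        simp [hl]
      · simp
    simp only [isthH, Matrix.sub_apply, Matrix.add_apply, Matrix.of_apply, if_true, this,
      Matrix.single_apply, and_self]
    ring
  · have : ¬(f j = i ∧ f j = i') := fun h => hi (h.1.symm.trans h.2)
    simp [isthH, hi, this]

theorem isthPD_eq (a m b d : ℕ) (M : Matrix (Fin (a + m + b)) (Fin (a + m + b)) ℝ)
    (f : Fin d → Fin (a + m + b)) (E : Fin d → ℝ) (j : Fin d) (z : Fin d → ℂ) (lam : ℂ)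
    (hz : z j ≠ 0) :
    isthPD a m b d M f E j z lam = E j * (1 - (z j ^ 2)⁻¹) *
      (isthH a m b d M f E z - lam • 1).principalMinor (Finset.univ.erase (f j)) := by
  simp only [isthPD, isthD_update]
  refine HasDerivAt.deriv ?_
  have h := ((((hasDerivAt_id (z j)).add (hasDerivAt_inv hz)).sub_const
    (z j + (z j)⁻¹)).const_mul (E j : ℂ)).mul_const
    ((isthH a m b d M f E z - lam • 1).principalMinor (Finset.univ.erase (f j)))
  simpa [sub_eq_add_neg] using h.const_add (isthD a m b d M f E z lam)

/-- In the isthmus setting with generic parameters, every critical point `(x,λ₀)` of `D`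
has `x` a corner point: `x_j² = 1` for every `j`. -/
theorem stmt_8 (a b m d : ℕ) (hm : 1 ≤ m) (hd : 1 ≤ d)
    (M : Matrix (Fin (a + m + b)) (Fin (a + m + b)) ℝ)
    (hMs : M.IsSymm)
    -- zero pattern of M
    (hM0 : ∀ i j : Fin (a + m + b), (i : ℕ) < (j : ℕ) →
      ¬((j : ℕ) + 1 ≤ a) → ¬(a + m ≤ (i : ℕ)) →
      ¬((j : ℕ) = (i : ℕ) + 1 ∧ a ≤ (i : ℕ) + 1 ∧ (i : ℕ) ≤ a + m - 1) →
      M i j = 0)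
    (f : Fin d → Fin (a + m + b))
    (hf : ∀ j, a ≤ (f j : ℕ) ∧ (f j : ℕ) ≤ a + m - 1)
    (E : Fin d → ℝ)
    -- (G1) the consecutive entries M_{i,i+1}, a−1 ≤ i ≤ a+m−1, and all E_j are nonzero
    (hG1M : ∀ i : ℕ, a ≤ i + 1 → i ≤ a + m - 1 → ∀ h : i + 1 < a + m + b,
      M ⟨i, by omega⟩ ⟨i + 1, h⟩ ≠ 0)
    (hG1E : ∀ j, E j ≠ 0)
    -- (G2) at corner points, P_t and Q_{t'} (t ≤ t' isthmus indices) have no common root,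
    -- and neither has a root in common with D
    (hG2 : ∀ x : Fin d → ℂ, (∀ j, x j = 1 ∨ x j = -1) →
      ∀ t t' : ℕ, a ≤ t → t ≤ t' → t' ≤ a + m - 1 → ∀ lam : ℂ,
        (¬(isthP a m b d M f E t x lam = 0 ∧ isthQ a m b d M f E t' x lam = 0)) ∧
        (isthD a m b d M f E x lam = 0 →
          isthP a m b d M f E t x lam ≠ 0 ∧ isthQ a m b d M f E t' x lam ≠ 0))
    -- (G3) the boundary minors have no common roots
    (hG3a : 0 < a → ∀ (x : Fin d → ℂ) (lam : ℂ),
      ¬(isthP a m b d M f E (a - 1) x lam = 0 ∧ isthP a m b d M f E a x lam = 0))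
    (hG3b : 0 < b → ∀ (x : Fin d → ℂ) (lam : ℂ),
      ¬(isthQ a m b d M f E (a + m - 1) x lam = 0 ∧ isthQ a m b d M f E (a + m) x lam = 0)) :
    ∀ (x : Fin d → ℂ) (lam0 : ℂ), (∀ j, x j ≠ 0) →
      isthD a m b d M f E x lam0 = 0 →
      (∀ j, isthPD a m b d M f E j x lam0 = 0) →
      ∀ j, (x j) ^ 2 = 1 := by
  intro x lam0 hx0 hD hcrit
  set N := isthH a m b d M f E x - lam0 • 1 with hNdef
  have hNne : ∀ i j, i ≠ j → N i j = (M i j : ℂ) := fun i j h => isthH_sub_smul_apply_of_ne h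
  have hN : ∀ k, a ≤ k + 1 → k + 1 ≤ a + m → ∀ i j : Fin (a + m + b), (i : ℕ) ≤ k →
      k + 1 ≤ (j : ℕ) → ¬((i : ℕ) = k ∧ (j : ℕ) = k + 1) → N i j = 0 ∧ N j i = 0 := by
    intro k h₁ h₂ i j hi hj hij
    have hne : i ≠ j := fun h => by subst h; omega
    have hM : M i j = 0 := hM0 i j (by omega) (by omega) (by omega) (by omega)
    rw [hNne i j hne, hNne j i hne.symm, hMs.apply i j, hM]
    simp
  have hne : ∀ k, a ≤ k + 1 → k + 1 ≤ a + m → ∀ h : k + 1 < a + m + b,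
      N ⟨k, by omega⟩ ⟨k + 1, h⟩ * N ⟨k + 1, h⟩ ⟨k, by omega⟩ ≠ 0 := by
    intro k h₁ h₂ h
    rw [hNne _ _ (by simp), hNne _ _ (by simp), hMs.apply ⟨k, by omega⟩ ⟨k + 1, h⟩]
    have := hG1M k h₁ (by omega) h
    simpa using this
  have hiff : ∀ t, a ≤ t → t < a + m →
      (N.intervalMinor 0 t = 0 ↔ N.intervalMinor (t + 1) (a + m + b) = 0) := by
    intro t h₁ h₂
    refine Matrix.intervalMinor_eq_zero_iff_of_isthmus (by omega) N hN hne ?_ ?_ hD h₁ h₂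
    · simpa only [isthP, Matrix.Pminor_eq_intervalMinor] using fun h => hG3a h x lam0
    · intro h
      have := hG3b (by omega) x lam0
      rwa [isthQ, isthQ, Matrix.Qminor_eq_intervalMinor, Matrix.Qminor_eq_intervalMinor,
        Nat.sub_add_cancel (by omega)] at this
  have hvanish : ∀ j, x j ^ 2 ≠ 1 →
      N.intervalMinor 0 (f j) = 0 ∧ N.intervalMinor (f j + 1) (a + m + b) = 0 := by
    intro j hj
    obtain ⟨h₁, h₂⟩ := hf j
    have h := hcrit j
    rw [isthPD_eq _ _ _ _ _ _ _ _ _ _ (hx0 j), ← hNdef,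
      Matrix.principalMinor_erase_of_separates] at h
    · have hE : (E j : ℂ) ≠ 0 := by exact_mod_cast hG1E j
      have hxj : 1 - (x j ^ 2)⁻¹ ≠ 0 := fun h => hj (by simpa using (sub_eq_zero.1 h).symm)
      have hPQ := hiff (f j) h₁ (by omega)
      simp only [mul_eq_zero, hE, hxj, false_or] at h
      tauto
    · intro i i' hi hi'
      rw [Fin.lt_def] at hi hi'
      exact (hN (f j) (by omega) (by omega) i i' (by omega) (by omega) (by omega)).1
  by_contra! hbad
  let J := Finset.univ.filter fun j => x j ^ 2 ≠ 1
  have hJ : J.Nonempty := by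
    obtain ⟨j, hj⟩ := hbad
    exact ⟨j, Finset.mem_filter.2 ⟨Finset.mem_univ j, hj⟩⟩
  obtain ⟨j₁, hj₁, hmin⟩ := J.exists_min_image (fun j => (f j : ℕ)) hJ
  obtain ⟨j₂, hj₂, hmax⟩ := J.exists_max_image (fun j => (f j : ℕ)) hJ
  let y : Fin d → ℂ := fun j => if x j ^ 2 = 1 then x j else 1
  have hy : ∀ j, y j = 1 ∨ y j = -1 := by
    intro j
    dsimp only [y]
    split_ifs with h
    · simpa using h
    · exact Or.inl rfl
  have hxy : ∀ j, j ∉ J → x j = y j := by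
    intro j hj
    have : x j ^ 2 = 1 := by
      by_contra h
      exact hj (Finset.mem_filter.2 ⟨Finset.mem_univ j, h⟩)
    exact (if_pos this).symm
  refine (hG2 y hy (f j₁) (f j₂) (hf j₁).1 (hmin j₂ hj₂) (hf j₂).2 lam0).1 ⟨?_, ?_⟩
  · rw [isthP, Matrix.Pminor_eq_intervalMinor, ← (hvanish j₁ (Finset.mem_filter.1 hj₁).2).1]
    refine (Matrix.intervalMinor_congr fun i j _ hi => isthH_sub_smul_congr fun l hl => ?_).symm
    refine hxy l fun hlJ => ?_
    have := hmin l hlJ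
    subst hl
    omega
  · rw [isthQ, Matrix.Qminor_eq_intervalMinor, ← (hvanish j₂ (Finset.mem_filter.1 hj₂).2).2]
    refine (Matrix.intervalMinor_congr fun i j hi _ => isthH_sub_smul_congr fun l hl => ?_).symm
    refine hxy l fun hlJ => ?_
    have := hmax l hlJ
    subst hl
    omega
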